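/- arXiv:2510.01580 — 2 statements merged into one kernel-verified Lean document; each statement's English description precedes it below -/
import Mathlib

section
/- Suppose W(t) = W and Λ(t) = Λ = diag(λ_1,…,λ_n) are constant in time, so that Φ(t,0) = (ΛW)^t. Then ‖(ΛW)^t‖ → 0 as t → ∞ if and only if for every agent i there exist an integer m with 0 ≤ m ≤ n and agents i_0, i_1, …, i_m = i such that λ_{i_0} < 1 and W_{i_{k+1}, i_k} > 0 for every 0 ≤ k < m (i.e., every agent is stubborn or is reached from a stubborn agent by a directed path of length at most n in the graph of W). -/
open Matrix Finset Filter

noncomputable section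

/-- Maximum absolute row-sum norm of a matrix. -/
noncomputable def rowNorm {n : ℕ} (A : Matrix (Fin n) (Fin n) ℝ) : ℝ :=
  ⨆ i, ∑ j, |A i j|

/-- Auxiliary product: `PhiAux lam W τ k = Λ(τ+k-1)W(τ+k-1) ⋯ Λ(τ)W(τ)`. -/
noncomputable def PhiAux {n : ℕ} (lam : ℕ → Fin n → ℝ)
    (W : ℕ → Matrix (Fin n) (Fin n) ℝ) (τ : ℕ) : ℕ → Matrix (Fin n) (Fin n) ℝ
  | 0 => 1
  | k + 1 => (Matrix.diagonal (lam (τ + k)) * W (τ + k)) * PhiAux lam W τ k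

/-- State-transition matrix `Φ(t,τ) = Λ(t−1)W(t−1) ⋯ Λ(τ)W(τ)`, `Φ(τ,τ) = I`. -/
noncomputable def Phi {n : ℕ} (lam : ℕ → Fin n → ℝ)
    (W : ℕ → Matrix (Fin n) (Fin n) ℝ) (t τ : ℕ) : Matrix (Fin n) (Fin n) ℝ :=
  PhiAux lam W τ (t - τ)

/-- The sum of row `i` of a product of square matrices. -/
theorem sum_row_mul {n : ℕ} (A B : Matrix (Fin n) (Fin n) ℝ) (i : Fin n) :
    ∑ j, (A * B) i j = ∑ k, A i k * ∑ j, B k j := by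
  simp only [Matrix.mul_apply, Finset.mul_sum]
  exact Finset.sum_comm

theorem sum_row_diagonal_mul_pow_succ {n : ℕ} (lam : Fin n → ℝ) (W : Matrix (Fin n) (Fin n) ℝ)
    (t : ℕ) (i : Fin n) :
    ∑ j, ((Matrix.diagonal lam * W) ^ (t + 1)) i j =
      lam i * ∑ k, W i k * ∑ j, ((Matrix.diagonal lam * W) ^ t) k j := by
  rw [pow_succ', sum_row_mul, Finset.mul_sum]
  simp only [Matrix.diagonal_mul, mul_assoc]

theorem pow_entry_nonneg {n : ℕ} {A : Matrix (Fin n) (Fin n) ℝ} (hA : ∀ i j, 0 ≤ A i j)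
    (t : ℕ) (i j : Fin n) : 0 ≤ (A ^ t) i j := by
  induction t generalizing i j with
  | zero =>
    rw [pow_zero, Matrix.one_apply]
    split_ifs <;> norm_num
  | succ t ih =>
    rw [pow_succ, Matrix.mul_apply]
    exact Finset.sum_nonneg fun k _ => mul_nonneg (ih i k) (hA k j)

theorem rowNorm_nonneg {n : ℕ} (A : Matrix (Fin n) (Fin n) ℝ) : 0 ≤ rowNorm A :=
  Real.iSup_nonneg fun _ => Finset.sum_nonneg fun _ _ => abs_nonneg _

theorem sum_row_le_rowNorm {n : ℕ} (A : Matrix (Fin n) (Fin n) ℝ) (i : Fin n) :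
    ∑ j, A i j ≤ rowNorm A :=
  (Finset.sum_le_sum fun _ _ => le_abs_self _).trans
    (le_ciSup (f := fun i => ∑ j, |A i j|) (Set.finite_range _).bddAbove i)

theorem rowNorm_le {n : ℕ} {A : Matrix (Fin n) (Fin n) ℝ} {c : ℝ} (hA : ∀ i j, 0 ≤ A i j)
    (hc : 0 ≤ c) (h : ∀ i, ∑ j, A i j ≤ c) : rowNorm A ≤ c :=
  Real.iSup_le (fun i => by simpa only [abs_of_nonneg (hA i _)] using h i) hc

/-- The row norm is submultiplicative on nonnegative matrices. -/
theorem rowNorm_mul_le {n : ℕ} {A B : Matrix (Fin n) (Fin n) ℝ} (hA : ∀ i j, 0 ≤ A i j)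
    (hB : ∀ i j, 0 ≤ B i j) : rowNorm (A * B) ≤ rowNorm A * rowNorm B := by
  refine rowNorm_le (fun i j => ?_) (mul_nonneg (rowNorm_nonneg A) (rowNorm_nonneg B)) fun i => ?_
  · rw [Matrix.mul_apply]
    exact Finset.sum_nonneg fun k _ => mul_nonneg (hA i k) (hB k j)
  · rw [sum_row_mul]
    calc ∑ k, A i k * ∑ j, B k j ≤ ∑ k, A i k * rowNorm B :=
          Finset.sum_le_sum fun k _ => mul_le_mul_of_nonneg_left (sum_row_le_rowNorm B k) (hA i k)
      _ = (∑ k, A i k) * rowNorm B := (Finset.sum_mul ..).symm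
      _ ≤ rowNorm A * rowNorm B :=
          mul_le_mul_of_nonneg_right (sum_row_le_rowNorm A i) (rowNorm_nonneg B)

/-- If some power of a nonnegative matrix of row norm at most one has row norm less than one,
then its powers tend to zero. -/
theorem tendsto_rowNorm_pow {n : ℕ} {A : Matrix (Fin n) (Fin n) ℝ} (hA : ∀ i j, 0 ≤ A i j)
    (h1 : rowNorm A ≤ 1) {N : ℕ} (hN : rowNorm (A ^ N) < 1) :
    Tendsto (fun t => rowNorm (A ^ t)) atTop (nhds 0) := by
  have hanti : Antitone fun t => rowNorm (A ^ t) := antitone_nat_of_succ_le fun t => by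
    rw [pow_succ]
    exact (rowNorm_mul_le (pow_entry_nonneg hA t) hA).trans
      (mul_le_of_le_one_right (rowNorm_nonneg _) h1)
  obtain ⟨l, hl⟩ : ∃ l, Tendsto (fun t => rowNorm (A ^ t)) atTop (nhds l) :=
    ⟨_, tendsto_atTop_ciInf hanti ⟨0, by rintro _ ⟨t, rfl⟩; exact rowNorm_nonneg _⟩⟩
  have hl0 : 0 ≤ l := ge_of_tendsto' hl fun t => rowNorm_nonneg _
  have hle : l ≤ rowNorm (A ^ N) * l :=
    le_of_tendsto_of_tendsto' ((tendsto_add_atTop_iff_nat N).2 hl) (hl.const_mul _) fun t => by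
      rw [add_comm, pow_add]
      exact rowNorm_mul_le (pow_entry_nonneg hA N) (pow_entry_nonneg hA t)
  have hl_zero : l = 0 := by nlinarith
  exact hl_zero ▸ hl

/-- A walk with more steps than there are vertices can be shortened without changing its
endpoints. -/
theorem exists_short_walk {n : ℕ} (r : Fin n → Fin n → Prop) (m : ℕ) (a : ℕ → Fin n)
    (ha : ∀ k, k < m → r (a (k + 1)) (a k)) :
    ∃ m' ≤ n, ∃ b : ℕ → Fin n, b m' = a m ∧ b 0 = a 0 ∧ ∀ k, k < m' → r (b (k + 1)) (b k) := by
  induction m using Nat.strong_induction_on generalizing a with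
  | _ m ih =>
  rcases le_or_gt m n with hm | hm
  · exact ⟨m, hm, a, rfl, rfl, ha⟩
  obtain ⟨k, l, hkl, hlm, hal⟩ : ∃ k l, k < l ∧ l ≤ m ∧ a k = a l := by
    obtain ⟨x, y, hxy, h⟩ := Fintype.exists_ne_map_eq_of_card_lt
      (fun x : Fin (m + 1) => a x) (by simp; omega)
    rcases lt_or_gt_of_ne hxy with hlt | hlt
    · exact ⟨x, y, hlt, by omega, h⟩
    · exact ⟨y, x, hlt, by omega, h.symm⟩
  obtain ⟨m', hm', b, hb, hb0, hbr⟩ := ih (m - (l - k)) (by omega)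
    (fun x => if x < k then a x else a (x + (l - k))) (fun x hx => by
      rcases lt_trichotomy (x + 1) k with hxk | hxk | hxk
      · rw [if_pos hxk, if_pos (by omega)]
        exact ha x (by omega)
      · rw [if_neg (by omega), if_pos (by omega), show x + 1 + (l - k) = l by omega, ← hal, ← hxk]
        exact ha x (by omega)
      · rw [if_neg (by omega), if_neg (by omega), show x + 1 + (l - k) = x + (l - k) + 1 by omega]
        exact ha _ (by omega))
  refine ⟨m', hm', b, ?_, ?_, hbr⟩
  · rw [hb, if_neg (by omega)]
    congr 1
    omega
  · rw [hb0]
    split_ifs with hk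
    · rfl
    · obtain rfl : k = 0 := by omega
      simpa using hal.symm

/-- time-invariant FJ stability criterion: `‖(ΛW)^t‖ → 0` iff every
agent is stubborn or reached from a stubborn agent by a directed path of length
at most `n` in the graph of `W`. -/
theorem tifj_stability_iff {n : ℕ} (hn : 1 ≤ n)
    (lam : Fin n → ℝ) (W : Matrix (Fin n) (Fin n) ℝ)
    (hW0 : ∀ i j, 0 ≤ W i j) (hW1 : ∀ i, ∑ j, W i j = 1)
    (hlam : ∀ i, 0 ≤ lam i ∧ lam i ≤ 1) :
    Filter.Tendsto (fun t => rowNorm ((Matrix.diagonal lam * W) ^ t))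
        Filter.atTop (nhds 0) ↔
      ∀ i : Fin n, ∃ m : ℕ, m ≤ n ∧ ∃ a : ℕ → Fin n, a m = i ∧ lam (a 0) < 1 ∧
        ∀ k, k < m → 0 < W (a (k + 1)) (a k) := by
  have hA : ∀ i j, 0 ≤ (Matrix.diagonal lam * W) i j := fun i j => by
    rw [Matrix.diagonal_mul]
    exact mul_nonneg (hlam i).1 (hW0 i j)
  constructor
  · intro h i
    by_contra hi
    let Unreached : Fin n → Prop := fun i => ∀ (m : ℕ) (a : ℕ → Fin n), a m = i →
      (∀ k, k < m → 0 < W (a (k + 1)) (a k)) → lam (a 0) = 1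
    have hun : Unreached i := fun m a ham ha => by
      by_contra hne
      obtain ⟨m', hm', b, hb, hb0, hbr⟩ := exists_short_walk (fun x y => 0 < W x y) m a ha
      exact hi ⟨m', hm', b, hb.trans ham, hb0 ▸ lt_of_le_of_ne (hlam _).2 hne, hbr⟩
    have hpred : ∀ i j, Unreached i → 0 < W i j → Unreached j := fun i j hi hij m a ham ha => by
      have := hi (m + 1) (fun k => if k ≤ m then a k else i) (by simp) (fun k hk => by
        rcases Nat.lt_succ_iff_lt_or_eq.1 hk with hk | rfl
        · rw [if_pos (by omega), if_pos (by omega)]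
          exact ha k hk
        · rwa [if_neg (by omega), if_pos le_rfl, ham])
      simpa using this
    have hsum : ∀ t i, Unreached i → ∑ j, ((Matrix.diagonal lam * W) ^ t) i j = 1 := by
      intro t
      induction t with
      | zero => intro i _; simp [Matrix.one_apply]
      | succ t ih =>
        intro i hi
        rw [sum_row_diagonal_mul_pow_succ, show lam i = 1 from hi 0 (fun _ => i) rfl (by simp),
          one_mul, ← hW1 i]
        refine Finset.sum_congr rfl fun k _ => ?_
        rcases (hW0 i k).eq_or_lt with hk | hk
        · rw [← hk, zero_mul]
        · rw [ih k (hpred i k hi hk), mul_one]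
    have := ge_of_tendsto' h fun t => (hsum t i hun).symm.le.trans (sum_row_le_rowNorm _ i)
    norm_num at this
  · intro h
    have hle : ∀ t i, ∑ j, ((Matrix.diagonal lam * W) ^ t) i j ≤ 1 := by
      intro t
      induction t with
      | zero => intro i; simp [Matrix.one_apply]
      | succ t ih =>
        intro i
        rw [sum_row_diagonal_mul_pow_succ]
        refine mul_le_one₀ (hlam i).2 (Finset.sum_nonneg fun k _ => mul_nonneg (hW0 i k)
          (Finset.sum_nonneg fun j _ => pow_entry_nonneg hA t k j)) ?_
        rw [← hW1 i]
        exact Finset.sum_le_sum fun k _ => mul_le_of_le_one_right (hW0 i k) (ih k)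
    have h1 : rowNorm (Matrix.diagonal lam * W) ≤ 1 :=
      rowNorm_le hA zero_le_one fun i => by simpa only [pow_one] using hle 1 i
    have hanti : ∀ i, Antitone fun t => ∑ j, ((Matrix.diagonal lam * W) ^ t) i j := fun i =>
      antitone_nat_of_succ_le fun t => by
        rw [pow_succ, sum_row_mul]
        exact Finset.sum_le_sum fun k _ => mul_le_of_le_one_right (pow_entry_nonneg hA t i k)
          (by simpa only [pow_one] using hle 1 k)
    have hlt : ∀ i, ∑ j, ((Matrix.diagonal lam * W) ^ (n + 1)) i j < 1 := fun i => by
      obtain ⟨m, hm, a, rfl, ha0, ha⟩ := h i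
      have hwalk : ∀ k ≤ m, ∑ j, ((Matrix.diagonal lam * W) ^ (k + 1)) (a k) j < 1 := by
        intro k
        induction k with
        | zero =>
          intro _
          rw [sum_row_diagonal_mul_pow_succ]
          simpa [Matrix.one_apply, hW1] using ha0
        | succ k ih =>
          intro hk
          rw [sum_row_diagonal_mul_pow_succ]
          refine (mul_le_of_le_one_left (Finset.sum_nonneg fun l _ => mul_nonneg (hW0 _ l)
            (Finset.sum_nonneg fun j _ => pow_entry_nonneg hA _ l j)) (hlam _).2).trans_lt ?_
          rw [← hW1 (a (k + 1))]
          exact Finset.sum_lt_sum (fun l _ => mul_le_of_le_one_right (hW0 _ l) (hle _ l))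
            ⟨a k, Finset.mem_univ _, mul_lt_of_lt_one_right (ha k (by omega)) (ih (by omega))⟩
      exact (hanti (a m) (by omega : m + 1 ≤ n + 1)).trans_lt (hwalk m le_rfl)
    refine tendsto_rowNorm_pow hA h1 (N := n + 1) ?_
    have : Nonempty (Fin n) := ⟨⟨0, hn⟩⟩
    obtain ⟨i, hi⟩ := exists_eq_ciSup_of_finite
      (f := fun i => ∑ j, |((Matrix.diagonal lam * W) ^ (n + 1)) i j|)
    rw [rowNorm, ← hi]
    simpa only [abs_of_nonneg (pow_entry_nonneg hA _ _ _)] using hlt i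
end
end

section
/- Suppose Λ(t+p) = Λ(t) and W(t+p) = W(t) for all t ∈ ℕ (period p ≥ 1), ρ := ‖Φ(p, 0)‖ < 1, and x satisfies x(t+1) = Λ(t)W(t)x(t) + (I − Λ(t))s with arbitrary x(0) ∈ ℝⁿ. Then for each l ∈ {0, 1, …, p−1}: the matrix I − M_l is invertible, where M_l := Φ(l+p, l), and the subsequence x(kp + l) converges as k → ∞ to x_l* := (I − M_l)^{−1} N_l s, where N_l := Σ_{j=0}^{p−1} Φ(l+p, l+j+1)(I − Λ(l+j)); the limits x_l* do not depend on x(0). Consequently, the set of accumulation points of the sequence (x(t))_{t∈ℕ} has at most p elements. -/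
open Matrix Finset Filter

noncomputable section

open Topology

section RowNorm

attribute [local instance] Matrix.linftyOpNormedRing Matrix.linftyOpNormedAlgebra

lemma norm_le_rowNorm {n : ℕ} (M : Matrix (Fin n) (Fin n) ℝ) : ‖M‖ ≤ rowNorm M := by
  have hnonneg : 0 ≤ rowNorm M :=
    Real.iSup_nonneg fun i => Finset.sum_nonneg fun j _ => abs_nonneg (M i j)
  rw [Matrix.linfty_opNorm_def, ← NNReal.coe_mk _ hnonneg, NNReal.coe_le_coe]
  refine Finset.sup_le fun i _ => ?_
  rw [← NNReal.coe_le_coe]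
  simpa [rowNorm] using le_ciSup (f := fun i => ∑ j, |M i j|) (Set.finite_range _).bddAbove i

lemma isUnit_one_sub_of_rowNorm_lt_one {n : ℕ} {M : Matrix (Fin n) (Fin n) ℝ}
    (h : rowNorm M < 1) : IsUnit (1 - M) :=
  haveI : @CompleteSpace (Matrix (Fin n) (Fin n) ℝ) PseudoMetricSpace.toUniformSpace :=
    FiniteDimensional.complete ℝ _
  isUnit_one_sub_of_norm_lt_one ((norm_le_rowNorm M).trans_lt h)

lemma tendsto_pow_of_rowNorm_lt_one {n : ℕ} {M : Matrix (Fin n) (Fin n) ℝ}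
    (h : rowNorm M < 1) : Tendsto (fun k : ℕ => M ^ k) atTop (𝓝 0) :=
  tendsto_pow_atTop_nhds_zero_of_norm_lt_one ((norm_le_rowNorm M).trans_lt h)

end RowNorm

lemma isUnit_one_sub_mul_swap {n : ℕ} {B C : Matrix (Fin n) (Fin n) ℝ}
    (h : IsUnit (1 - C * B)) : IsUnit (1 - B * C) := by
  rw [Matrix.isUnit_iff_isUnit_det] at h ⊢
  rwa [Matrix.det_one_sub_mul_comm]

lemma tendsto_pow_mul_swap {n : ℕ} {B C : Matrix (Fin n) (Fin n) ℝ}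
    (h : Tendsto (fun k : ℕ => (C * B) ^ k) atTop (𝓝 0)) :
    Tendsto (fun k : ℕ => (B * C) ^ k) atTop (𝓝 0) := by
  have hpow (k : ℕ) : (B * C) ^ (k + 1) = B * (C * B) ^ k * C := by
    induction k with
    | zero => simp
    | succ k ih => rw [pow_succ, ih, pow_succ (C * B)]; simp only [mul_assoc]
  rw [← tendsto_add_atTop_iff_nat 1]
  simp only [hpow]
  simpa using (h.const_mul B).mul_const C

/-- Iterates of an affine map whose linear part has powers tending to zero converge to
its fixed point. -/
lemma tendsto_affine_iterate {n : ℕ} {M : Matrix (Fin n) (Fin n) ℝ} (hunit : IsUnit (1 - M))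
    (hpow : Tendsto (fun k : ℕ => M ^ k) atTop (𝓝 0)) (c : Fin n → ℝ) (z : ℕ → Fin n → ℝ)
    (hz : ∀ k, z (k + 1) = M *ᵥ z k + c) :
    Tendsto z atTop (𝓝 ((1 - M)⁻¹ *ᵥ c)) := by
  set v := (1 - M)⁻¹ *ᵥ c with hv
  have hfix : v = M *ᵥ v + c := by
    have hc : (1 - M) *ᵥ v = c := by
      rw [hv, Matrix.mulVec_mulVec,
        Matrix.mul_nonsing_inv _ ((Matrix.isUnit_iff_isUnit_det _).1 hunit), Matrix.one_mulVec]
    rw [Matrix.sub_mulVec, Matrix.one_mulVec] at hc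
    rw [← hc]
    abel
  have hiter (k : ℕ) : z k = M ^ k *ᵥ (z 0 - v) + v := by
    induction k with
    | zero => simp
    | succ k ih =>
      rw [hz, ih, Matrix.mulVec_add, Matrix.mulVec_mulVec, ← pow_succ', add_assoc, ← hfix]
  have hcont : Continuous fun A : Matrix (Fin n) (Fin n) ℝ => A *ᵥ (z 0 - v) + v := by
    fun_prop
  have hlim := (hcont.tendsto 0).comp hpow
  rw [Matrix.zero_mulVec, zero_add] at hlim
  exact hlim.congr fun k => (hiter k).symm

lemma Phi_self {n : ℕ} (lam : ℕ → Fin n → ℝ) (W : ℕ → Matrix (Fin n) (Fin n) ℝ) (t : ℕ) :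
    Phi lam W t t = 1 := by
  simp [Phi, PhiAux]

lemma Phi_succ {n : ℕ} (lam : ℕ → Fin n → ℝ) (W : ℕ → Matrix (Fin n) (Fin n) ℝ) {t τ : ℕ}
    (h : τ ≤ t) :
    Phi lam W (t + 1) τ = (Matrix.diagonal (lam t) * W t) * Phi lam W t τ := by
  obtain ⟨k, rfl⟩ := Nat.exists_eq_add_of_le h
  simp [Phi, add_assoc, PhiAux]

lemma Phi_mul_Phi {n : ℕ} (lam : ℕ → Fin n → ℝ) (W : ℕ → Matrix (Fin n) (Fin n) ℝ)
    {t r τ : ℕ} (hr : r ≤ t) (hτ : τ ≤ r) :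
    Phi lam W t r * Phi lam W r τ = Phi lam W t τ := by
  induction t, hr using Nat.le_induction with
  | base => rw [Phi_self, one_mul]
  | succ t hr ih => rw [Phi_succ _ _ hr, Phi_succ _ _ (hτ.trans hr), mul_assoc, ih]

lemma Phi_add_period {n : ℕ} {lam : ℕ → Fin n → ℝ} {W : ℕ → Matrix (Fin n) (Fin n) ℝ} {p : ℕ}
    (hlam : Function.Periodic lam p) (hW : Function.Periodic W p) {t τ : ℕ} (h : τ ≤ t) :
    Phi lam W (t + p) (τ + p) = Phi lam W t τ := by
  induction t, h using Nat.le_induction with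
  | base => rw [Phi_self, Phi_self]
  | succ t h ih =>
    rw [add_right_comm, Phi_succ _ _ (Nat.add_le_add_right h p), Phi_succ _ _ h, ih, hlam, hW]

/-- Variation of constants formula. -/
lemma eq_Phi_mulVec_add {n : ℕ} {lam : ℕ → Fin n → ℝ} {W : ℕ → Matrix (Fin n) (Fin n) ℝ}
    {s : Fin n → ℝ} {x : ℕ → Fin n → ℝ}
    (hx : ∀ t, x (t + 1) =
      (Matrix.diagonal (lam t) * W t) *ᵥ x t + (1 - Matrix.diagonal (lam t)) *ᵥ s)
    (l k : ℕ) :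
    x (l + k) = Phi lam W (l + k) l *ᵥ x l +
      (∑ j ∈ Finset.range k,
        Phi lam W (l + k) (l + j + 1) * (1 - Matrix.diagonal (lam (l + j)))) *ᵥ s := by
  induction k with
  | zero => simp [Phi_self]
  | succ k ih =>
    have hsum : ∑ j ∈ Finset.range k,
          Phi lam W (l + k + 1) (l + j + 1) * (1 - Matrix.diagonal (lam (l + j))) =
        (Matrix.diagonal (lam (l + k)) * W (l + k)) * ∑ j ∈ Finset.range k,
          Phi lam W (l + k) (l + j + 1) * (1 - Matrix.diagonal (lam (l + j))) := by
      rw [Finset.mul_sum]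
      refine Finset.sum_congr rfl fun j hj => ?_
      have := Finset.mem_range.1 hj
      rw [Phi_succ _ _ (by lia), mul_assoc]
    rw [← add_assoc, hx, ih, Finset.sum_range_succ, hsum, Phi_succ _ _ (Nat.le_add_right l k),
      Phi_self, one_mul, Matrix.add_mulVec, Matrix.mulVec_add, Matrix.mulVec_mulVec,
      Matrix.mulVec_mulVec, add_assoc]

/-- If the sequence converges along every residue class mod `p`, then each subsequential
limit is one of the limits along the residue classes. -/
lemma exists_eq_of_tendsto_residues {α : Type*} [TopologicalSpace α] [T2Space α] {p : ℕ}
    (hp : 0 < p) {x : ℕ → α} {L : ℕ → α}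
    (hL : ∀ l < p, Tendsto (fun k => x (k * p + l)) atTop (𝓝 (L l)))
    {u : ℕ → ℕ} (hu : Tendsto u atTop atTop) {y : α}
    (hy : Tendsto (fun k => x (u k)) atTop (𝓝 y)) : ∃ l < p, L l = y := by
  obtain ⟨l, hl, hfreq⟩ : ∃ l < p, ∃ᶠ k in atTop, u k % p = l := by
    by_contra! hcon
    have hev : ∀ᶠ k in atTop, ∀ l ∈ Finset.range p, u k % p ≠ l :=
      (Filter.eventually_all_finset _).2 fun l hl =>
        hcon l (Finset.mem_range.1 hl)
    obtain ⟨k, hk⟩ := hev.exists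
    exact hk _ (Finset.mem_range.2 (Nat.mod_lt _ hp)) rfl
  obtain ⟨φ, hφ, hmod⟩ := Filter.extraction_of_frequently_atTop hfreq
  refine ⟨l, hl, tendsto_nhds_unique ?_ (hy.comp hφ.tendsto_atTop)⟩
  have hdiv : Tendsto (fun k => u (φ k) / p) atTop atTop :=
    (Nat.tendsto_div_const_atTop hp.ne').comp (hu.comp hφ.tendsto_atTop)
  refine ((hL l hl).comp hdiv).congr fun k => ?_
  simp only [Function.comp_apply]
  rw [← hmod k, Nat.div_add_mod']

lemma exists_finset_of_tendsto_residues {α : Type*} [TopologicalSpace α] [T2Space α] {p : ℕ}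
    (hp : 0 < p) {x : ℕ → α} {L : ℕ → α}
    (hL : ∀ l < p, Tendsto (fun k => x (k * p + l)) atTop (𝓝 (L l))) :
    ∃ S : Finset α, S.card ≤ p ∧ ∀ y : α,
      (∃ u : ℕ → ℕ, StrictMono u ∧ Tendsto (fun k => x (u k)) atTop (𝓝 y)) → y ∈ S := by
  classical
  refine ⟨(Finset.range p).image L, Finset.card_image_le.trans_eq (Finset.card_range p), ?_⟩
  rintro y ⟨u, hu, hy⟩
  obtain ⟨l, hl, rfl⟩ := exists_eq_of_tendsto_residues hp hL hu.tendsto_atTop hy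
  exact Finset.mem_image_of_mem _ (Finset.mem_range.2 hl)

/-- for a periodically switching FJ model with `‖Φ(p,0)‖ < 1`:
`I − M_l` is invertible, each subsequence `x(kp+l)` converges to
`x_l* = (I − M_l)⁻¹ N_l s` (independent of `x(0)`), and the set of accumulation
points of `(x(t))` has at most `p` elements. -/
theorem psfj_omega_limit_set {n : ℕ} (hn : 1 ≤ n)
    (lam : ℕ → Fin n → ℝ) (W : ℕ → Matrix (Fin n) (Fin n) ℝ)
    (hW0 : ∀ t i j, 0 ≤ W t i j) (hW1 : ∀ t i, ∑ j, W t i j = 1)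
    (hlam : ∀ t i, 0 ≤ lam t i ∧ lam t i ≤ 1)
    (p : ℕ) (hp : 1 ≤ p)
    (hper : ∀ t : ℕ, lam (t + p) = lam t ∧ W (t + p) = W t)
    (hρ : rowNorm (Phi lam W p 0) < 1)
    (s : Fin n → ℝ) (x : ℕ → Fin n → ℝ)
    (hx : ∀ t, x (t + 1) =
      (Matrix.diagonal (lam t) * W t) *ᵥ x t + (1 - Matrix.diagonal (lam t)) *ᵥ s) :
    (∀ l, l < p →
      IsUnit (1 - Phi lam W (l + p) l) ∧
      Filter.Tendsto (fun k => x (k * p + l)) Filter.atTop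
        (nhds ((1 - Phi lam W (l + p) l)⁻¹ *ᵥ
          ((∑ j ∈ Finset.range p,
            Phi lam W (l + p) (l + j + 1) * (1 - Matrix.diagonal (lam (l + j)))) *ᵥ s)))) ∧
    ∃ S : Finset (Fin n → ℝ), S.card ≤ p ∧
      ∀ y : Fin n → ℝ,
        (∃ tk : ℕ → ℕ, StrictMono tk ∧
          Filter.Tendsto (fun k => x (tk k)) Filter.atTop (nhds y)) →
        y ∈ S := by
  have hlamp : Function.Periodic lam p := fun t => (hper t).1
  have hWp : Function.Periodic W p := fun t => (hper t).2
  have hmain : ∀ l, l < p →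
      IsUnit (1 - Phi lam W (l + p) l) ∧
      Filter.Tendsto (fun k => x (k * p + l)) Filter.atTop
        (nhds ((1 - Phi lam W (l + p) l)⁻¹ *ᵥ
          ((∑ j ∈ Finset.range p,
            Phi lam W (l + p) (l + j + 1) * (1 - Matrix.diagonal (lam (l + j)))) *ᵥ s))) := by
    intro l hl
    have hM : Phi lam W (l + p) l = Phi lam W l 0 * Phi lam W p l := by
      rw [← Phi_mul_Phi lam W (Nat.le_add_left p l) hl.le,
        ← Phi_add_period hlamp hWp (Nat.zero_le l), zero_add]
    rw [← Phi_mul_Phi lam W hl.le (Nat.zero_le l)] at hρ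
    have hunit : IsUnit (1 - Phi lam W (l + p) l) :=
      hM ▸ isUnit_one_sub_mul_swap (isUnit_one_sub_of_rowNorm_lt_one hρ)
    have hpow : Tendsto (fun k : ℕ => Phi lam W (l + p) l ^ k) atTop (𝓝 0) :=
      hM ▸ tendsto_pow_mul_swap (tendsto_pow_of_rowNorm_lt_one hρ)
    refine ⟨hunit, tendsto_affine_iterate hunit hpow _ _ fun k => ?_⟩
    have hshift : ∀ t, x (k * p + (t + 1)) =
        (Matrix.diagonal (lam t) * W t) *ᵥ x (k * p + t) +
          (1 - Matrix.diagonal (lam t)) *ᵥ s := fun t => by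
      have hlamk : lam (k * p + t) = lam t := by
        rw [add_comm]; exact hlamp.nat_mul k t
      have hWk : W (k * p + t) = W t := by
        rw [add_comm]; exact hWp.nat_mul k t
      rw [← add_assoc, hx, hlamk, hWk]
    rw [show (k + 1) * p + l = k * p + (l + p) by ring]
    exact eq_Phi_mulVec_add (x := fun t => x (k * p + t)) hshift l p
  exact ⟨hmain, exists_finset_of_tendsto_residues hp fun l hl => (hmain l hl).2⟩
end
end
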